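/- Let M ≥ 2 be a natural number, κ > 0 a real, and α ∈ (0,1). The marginal rejection level of the chi-squared quantile pooled p-value chipool(·;κ) satisfies lim_{b→1⁻} sSup {p₁ ∈ (0,b] : chipool((p₁, b, …, b); κ) ≤ α} = 1 − F_χ( F_χ⁻¹(1 − α; Mκ); κ ). -/

import Mathlib

open Set Filter Topology

/-- `F_χ(·;κ)`: the CDF of the chi-squared distribution with real degrees of
freedom `κ`, i.e. of the Gamma distribution with shape `κ/2` and rate `1/2`. -/
noncomputable def chiSqCDF (κ : ℝ) : ℝ → ℝ :=
  fun x => ProbabilityTheory.cdf (ProbabilityTheory.gammaMeasure (κ / 2) (1 / 2)) x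

/-- `F_χ⁻¹(q;κ)`: the quantile function of the chi-squared distribution. -/
noncomputable def chiSqInv (κ : ℝ) (q : ℝ) : ℝ := sInf {x : ℝ | q ≤ chiSqCDF κ x}

open MeasureTheory ProbabilityTheory in
theorem integrable_gammaPDFReal {a r : ℝ} (ha : 0 < a) (hr : 0 < r) :
    Integrable (gammaPDFReal a r) := by
  refine ⟨by fun_prop, ?_⟩
  rw [hasFiniteIntegral_iff_ofReal (ae_of_all _ (gammaPDFReal_nonneg ha hr))]
  exact (lintegral_gammaPDF_eq_one ha hr).trans_lt ENNReal.one_lt_top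

open ProbabilityTheory in
theorem chiSqCDF_sub {κ : ℝ} (hκ : 0 < κ) (x y : ℝ) :
    chiSqCDF κ y - chiSqCDF κ x = ∫ t in x..y, gammaPDFReal (κ / 2) (1 / 2) t := by
  have hi := integrable_gammaPDFReal (half_pos hκ) one_half_pos
  simp only [chiSqCDF, cdf_gammaMeasure_eq_integral (half_pos hκ) one_half_pos]
  exact intervalIntegral.integral_Iic_sub_Iic hi.integrableOn hi.integrableOn

theorem continuous_chiSqCDF {κ : ℝ} (hκ : 0 < κ) : Continuous (chiSqCDF κ) := by
  have hi := integrable_gammaPDFReal (half_pos hκ) one_half_pos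
  have h : chiSqCDF κ = fun y => chiSqCDF κ 0 +
      ∫ t in (0 : ℝ)..y, ProbabilityTheory.gammaPDFReal (κ / 2) (1 / 2) t := by
    ext y
    rw [← chiSqCDF_sub hκ, add_sub_cancel]
  rw [h]
  exact continuous_const.add
    (intervalIntegral.continuous_primitive (fun _ _ => hi.intervalIntegrable) 0)

theorem chiSqCDF_nonneg (κ x : ℝ) : 0 ≤ chiSqCDF κ x :=
  ProbabilityTheory.cdf_nonneg _ _

theorem monotone_chiSqCDF (κ : ℝ) : Monotone (chiSqCDF κ) :=
  ProbabilityTheory.monotone_cdf _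

theorem strictMonoOn_chiSqCDF {κ : ℝ} (hκ : 0 < κ) :
    StrictMonoOn (chiSqCDF κ) (Set.Ici 0) := by
  intro x hx y _ hxy
  have hi := integrable_gammaPDFReal (half_pos hκ) one_half_pos
  rw [← sub_pos, chiSqCDF_sub hκ]
  exact intervalIntegral.intervalIntegral_pos_of_pos_on hi.intervalIntegrable
    (fun t ht => ProbabilityTheory.gammaPDFReal_pos (half_pos hκ) one_half_pos
      ((Set.mem_Ici.1 hx).trans_lt ht.1)) hxy

open ProbabilityTheory in
theorem chiSqCDF_zero {κ : ℝ} (hκ : 0 < κ) : chiSqCDF κ 0 = 0 := by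
  rw [chiSqCDF, cdf_gammaMeasure_eq_integral (half_pos hκ) one_half_pos,
    MeasureTheory.integral_Iic_eq_integral_Iio]
  refine MeasureTheory.setIntegral_eq_zero_of_forall_eq_zero fun x hx => ?_
  rw [gammaPDFReal, if_neg (not_le.2 hx)]

theorem chiSqCDF_lt_one {κ x : ℝ} (hκ : 0 < κ) (hx : 0 ≤ x) : chiSqCDF κ x < 1 :=
  (strictMonoOn_chiSqCDF hκ hx (hx.trans (le_add_of_nonneg_right zero_le_one))
    (lt_add_one x)).trans_le (ProbabilityTheory.cdf_le_one _ _)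

theorem pos_of_chiSqCDF_pos {κ x : ℝ} (hκ : 0 < κ) (hx : 0 < chiSqCDF κ x) : 0 < x := by
  by_contra! h
  exact hx.not_ge ((monotone_chiSqCDF κ h).trans_eq (chiSqCDF_zero hκ))

theorem bddBelow_le_chiSqCDF {κ q : ℝ} (hκ : 0 < κ) (hq : 0 < q) :
    BddBelow {x : ℝ | q ≤ chiSqCDF κ x} :=
  ⟨0, fun _ hx => (pos_of_chiSqCDF_pos hκ (hq.trans_le hx)).le⟩

theorem le_chiSqCDF_chiSqInv {κ q : ℝ} (hκ : 0 < κ) (hq : q ∈ Set.Ioo (0 : ℝ) 1) :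
    q ≤ chiSqCDF κ (chiSqInv κ q) := by
  have hne : {x : ℝ | q ≤ chiSqCDF κ x}.Nonempty :=
    ((ProbabilityTheory.tendsto_cdf_atTop _).eventually_const_le hq.2).exists
  exact (isClosed_le continuous_const (continuous_chiSqCDF hκ)).csInf_mem hne
    (bddBelow_le_chiSqCDF hκ hq.1)

theorem chiSqInv_le_iff {κ q x : ℝ} (hκ : 0 < κ) (hq : q ∈ Set.Ioo (0 : ℝ) 1) :
    chiSqInv κ q ≤ x ↔ q ≤ chiSqCDF κ x :=
  ⟨fun h => (le_chiSqCDF_chiSqInv hκ hq).trans (monotone_chiSqCDF κ h),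
    fun h => csInf_le (bddBelow_le_chiSqCDF hκ hq.1) h⟩

theorem chiSqInv_pos {κ q : ℝ} (hκ : 0 < κ) (hq : q ∈ Set.Ioo (0 : ℝ) 1) :
    0 < chiSqInv κ q :=
  pos_of_chiSqCDF_pos hκ (hq.1.trans_le (le_chiSqCDF_chiSqInv hκ hq))

theorem le_chiSqInv_iff {κ q x : ℝ} (hκ : 0 < κ) (hq : q ∈ Set.Ioo (0 : ℝ) 1) (hx : 0 < x) :
    x ≤ chiSqInv κ q ↔ chiSqCDF κ x ≤ q := by
  constructor
  · intro h
    refine le_of_tendsto ((continuous_chiSqCDF hκ).tendsto x |>.mono_left nhdsWithin_le_nhds)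
      (eventually_nhdsWithin_of_forall (s := Set.Iio x) fun y hy => ?_)
    by_contra! hlt
    exact (((chiSqInv_le_iff hκ hq).2 hlt.le).trans_lt hy).not_ge h
  · intro h
    by_contra! hlt
    exact ((le_chiSqCDF_chiSqInv hκ hq).trans_lt
      (strictMonoOn_chiSqCDF hκ (chiSqInv_pos hκ hq).le hx.le hlt)).not_ge h

theorem tendsto_chiSqInv_zero {κ : ℝ} (hκ : 0 < κ) :
    Tendsto (chiSqInv κ) (𝓝[>] 0) (𝓝 0) := by
  have hmem : ∀ᶠ q : ℝ in 𝓝[>] 0, q ∈ Set.Ioo (0 : ℝ) 1 := Ioo_mem_nhdsGT zero_lt_one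
  refine tendsto_order.2 ⟨fun a ha => ?_, fun a ha => ?_⟩
  · filter_upwards [hmem] with q hq using ha.trans (chiSqInv_pos hκ hq)
  · have hF : 0 < chiSqCDF κ (a / 2) := by
      rw [← chiSqCDF_zero hκ]
      exact strictMonoOn_chiSqCDF hκ self_mem_Ici (half_pos ha).le (half_pos ha)
    filter_upwards [hmem, Ioo_mem_nhdsGT hF] with q hq hq'
    exact ((chiSqInv_le_iff hκ hq).2 hq'.2.le).trans_lt (half_lt_self ha)

/-- For `M ≥ 2`, `κ > 0` and `α ∈ (0,1)`, the marginal rejection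
level of the chi-squared quantile pooled p-value satisfies
`lim_{b→1⁻} sSup {p₁ ∈ (0,b] : chipool((p₁,b,…,b);κ) ≤ α}
  = 1 − F_χ(F_χ⁻¹(1 − α; Mκ); κ)`. -/
theorem chiPool_marginal_rejection
    (M : ℕ) (hM : 2 ≤ M) (κ : ℝ) (hκ : 0 < κ) (α : ℝ) (hα : α ∈ Set.Ioo (0 : ℝ) 1) :
    Tendsto (fun b : ℝ =>
        sSup {p₁ : ℝ | p₁ ∈ Set.Ioc (0 : ℝ) b ∧
          1 - chiSqCDF ((M : ℝ) * κ)
              (chiSqInv κ (1 - p₁) + ((M : ℝ) - 1) * chiSqInv κ (1 - b)) ≤ α})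
      (nhdsWithin 1 (Set.Iio 1))
      (nhds (1 - chiSqCDF κ (chiSqInv ((M : ℝ) * κ) (1 - α)))) := by
  have hMκ : 0 < (M : ℝ) * κ := mul_pos (by positivity) hκ
  have hα' : 1 - α ∈ Set.Ioo (0 : ℝ) 1 := ⟨by linarith [hα.2], by linarith [hα.1]⟩
  set t := chiSqInv ((M : ℝ) * κ) (1 - α)
  have ht : 0 < t := chiSqInv_pos hMκ hα'
  have hsub : Tendsto (fun b : ℝ => 1 - b) (𝓝[<] 1) (𝓝[>] 0) := by
    refine tendsto_nhdsWithin_iff.2 ⟨?_, ?_⟩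
    · exact ((continuous_const.sub continuous_id).tendsto' 1 0 (sub_self _)).mono_left
        nhdsWithin_le_nhds
    · filter_upwards [self_mem_nhdsWithin] with b hb using sub_pos.2 (Set.mem_Iio.1 hb)
  have hs : Tendsto (fun b : ℝ => t - ((M : ℝ) - 1) * chiSqInv κ (1 - b)) (𝓝[<] 1) (𝓝 t) := by
    simpa using (((tendsto_chiSqInv_zero hκ).comp hsub).const_mul ((M : ℝ) - 1)).const_sub t
  have hmin : Tendsto
      (fun b : ℝ => min b (1 - chiSqCDF κ (t - ((M : ℝ) - 1) * chiSqInv κ (1 - b))))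
      (𝓝[<] 1) (𝓝 (1 - chiSqCDF κ t)) := by
    have h := (tendsto_id.mono_left nhdsWithin_le_nhds : Tendsto id (𝓝[<] (1 : ℝ)) (𝓝 1)).min
      ((((continuous_chiSqCDF hκ).tendsto t).comp hs).const_sub 1)
    rwa [min_eq_right (sub_le_self _ (chiSqCDF_nonneg κ t))] at h
  refine hmin.congr' ?_
  filter_upwards [Ioo_mem_nhdsLT (zero_lt_one' ℝ), hs.eventually_const_lt ht] with b hb hsb
  rw [← csSup_Ioc (lt_min hb.1 (sub_pos.2 (chiSqCDF_lt_one hκ hsb.le)))]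
  congr 1
  ext p
  simp only [Set.mem_Ioc, Set.mem_ofPred_eq, le_min_iff, and_assoc]
  refine and_congr_right fun hp => and_congr_right fun hpb => ?_
  have hq : 1 - p ∈ Set.Ioo (0 : ℝ) 1 := ⟨by linarith [hb.2], by linarith⟩
  rw [le_sub_comm, ← le_chiSqInv_iff hκ hq hsb, sub_le_comm (b := chiSqCDF _ _),
    ← chiSqInv_le_iff hMκ hα', sub_le_iff_le_add]
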